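/- Let R be a commutative noetherian ring, a an ideal, and N an R̂-module (R̂ the a-adic completion) that is a-torsion. Then the flat dimension of N over R equals its flat dimension over R̂, and the injective dimension of N over R equals its injective dimension over R̂. In particular N is flat (resp. injective) over R if and only if it is flat (resp. injective) over R̂. -/

import Mathlib

open CategoryTheory CategoryTheory.Limits

/-- `N` has flat dimension at most `n` over `A`: it admits a flat resolution
`0 → F_n → ⋯ → F_1 → F_0 → N → 0`, i.e. a nonnegatively graded complex of flat modules,
vanishing in degrees `> n`, which is exact except in degree `0` where its homology is `N`. -/
def FlatDimLE (A : Type u) [CommRing A] (N : Type u) [AddCommGroup N] [Module A N]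
    (n : ℕ) : Prop :=
  ∃ C : ChainComplex (ModuleCat.{u} A) ℕ,
    (∀ i, Module.Flat A (C.X i)) ∧ (∀ i, n < i → Subsingleton (C.X i)) ∧
    (∀ i, i ≠ 0 → IsZero (C.homology i)) ∧
    Nonempty (C.homology 0 ≅ ModuleCat.of A N)

/-- `N` has injective dimension at most `n` over `A`: it admits an injective resolution
`0 → N → J^0 → J^1 → ⋯ → J^n → 0`. -/
def InjDimLE (A : Type u) [CommRing A] (N : Type u) [AddCommGroup N] [Module A N]
    (n : ℕ) : Prop :=
  ∃ C : CochainComplex (ModuleCat.{u} A) ℕ,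
    (∀ i, Injective (C.X i)) ∧ (∀ i, n < i → Subsingleton (C.X i)) ∧
    (∀ i, i ≠ 0 → IsZero (C.homology i)) ∧
    Nonempty (C.homology 0 ≅ ModuleCat.of A N)

universe u

section Noetherian

variable {R S : Type*} [CommRing R] [CommRing S] [Algebra R S] (a : Ideal R)

lemma exists_algebraMap_sub_mem_map_pow
    (hsurj : ∀ s : S, ∃ r : R, s - algebraMap R S r ∈ a.map (algebraMap R S)) (n : ℕ) {x : S}
    (hx : x ∈ (a.map (algebraMap R S)) ^ n) :
    ∃ c ∈ a ^ n, x - algebraMap R S c ∈ (a.map (algebraMap R S)) ^ (n + 1) := by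
  rw [← Ideal.map_pow, Ideal.map] at hx
  induction hx using Submodule.span_induction with
  | mem x h =>
    obtain ⟨c, hc, rfl⟩ := h
    exact ⟨c, hc, by simp⟩
  | zero => exact ⟨0, zero_mem _, by simp⟩
  | add x y _ _ ihx ihy =>
    obtain ⟨c, hc, hxc⟩ := ihx
    obtain ⟨d, hd, hyd⟩ := ihy
    refine ⟨c + d, add_mem hc hd, ?_⟩
    convert add_mem hxc hyd using 1
    rw [map_add]
    ring
  | smul s x _ ih =>
    obtain ⟨c, hc, hxc⟩ := ih
    obtain ⟨r, hr⟩ := hsurj s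
    refine ⟨r * c, Ideal.mul_mem_left _ _ hc, ?_⟩
    have hcS : algebraMap R S c ∈ (a.map (algebraMap R S)) ^ n := by
      rw [← Ideal.map_pow]
      exact Ideal.mem_map_of_mem _ hc
    have h : (s - algebraMap R S r) * algebraMap R S c ∈ (a.map (algebraMap R S)) ^ (n + 1) := by
      rw [pow_succ']
      exact Ideal.mul_mem_mul hr hcS
    convert add_mem (Ideal.mul_mem_left _ s hxc) h using 1
    rw [map_mul, smul_eq_mul]
    ring

lemma exists_sub_algebraMap_mem_map_pow
    (hsurj : ∀ s : S, ∃ r : R, s - algebraMap R S r ∈ a.map (algebraMap R S)) (n : ℕ) (s : S) :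
    ∃ r : R, s - algebraMap R S r ∈ (a.map (algebraMap R S)) ^ n := by
  induction n with
  | zero => exact ⟨0, by simp⟩
  | succ n ih =>
    obtain ⟨r, hr⟩ := ih
    obtain ⟨c, -, hc⟩ := exists_algebraMap_sub_mem_map_pow a hsurj n hr
    exact ⟨r + c, by rwa [map_add, ← sub_sub]⟩

/-- The filtration on `R` by the leading forms of the elements of an ideal of `S`. -/
def leadingFormFiltration (I : Ideal S) : a.Filtration R where
  N n :=
    { carrier := {c | c ∈ a ^ n ∧
        ∃ x ∈ I, x - algebraMap R S c ∈ (a.map (algebraMap R S)) ^ (n + 1)}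
      add_mem' := by
        rintro c d ⟨hc, x, hx, hxc⟩ ⟨hd, y, hy, hyd⟩
        refine ⟨add_mem hc hd, x + y, add_mem hx hy, ?_⟩
        rw [map_add, add_sub_add_comm]
        exact add_mem hxc hyd
      zero_mem' := ⟨zero_mem _, 0, zero_mem _, by simp⟩
      smul_mem' := by
        rintro r c ⟨hc, x, hx, hxc⟩
        refine ⟨Ideal.mul_mem_left _ _ hc, algebraMap R S r * x, Ideal.mul_mem_left _ _ hx, ?_⟩
        rw [smul_eq_mul, map_mul, ← mul_sub]
        exact Ideal.mul_mem_left _ _ hxc }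
  mono n := by
    rintro c ⟨hc, -⟩
    refine ⟨Ideal.pow_le_pow_right n.le_succ hc, 0, zero_mem _, ?_⟩
    rw [zero_sub, neg_mem_iff, ← Ideal.map_pow]
    exact Ideal.mem_map_of_mem _ hc
  smul_le n := by
    refine Submodule.smul_le.mpr ?_
    rintro r hr c ⟨hc, x, hx, hxc⟩
    refine ⟨?_, algebraMap R S r * x, Ideal.mul_mem_left _ _ hx, ?_⟩
    · rw [smul_eq_mul, pow_succ']
      exact Ideal.mul_mem_mul hr hc
    · rw [smul_eq_mul, map_mul, ← mul_sub, pow_succ' _ (n + 1)]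
      exact Ideal.mul_mem_mul (Ideal.mem_map_of_mem _ hr) hxc

lemma mem_leadingFormFiltration {I : Ideal S} {n : ℕ} {c : R} :
    c ∈ (leadingFormFiltration a I).N n ↔
      c ∈ a ^ n ∧ ∃ x ∈ I, x - algebraMap R S c ∈ (a.map (algebraMap R S)) ^ (n + 1) :=
  Iff.rfl

lemma leadingFormFiltration_stable [IsNoetherianRing R] (I : Ideal S) :
    (leadingFormFiltration a I).Stable := by
  refine (a.stableFiltration_stable ⊤).of_le fun n c hc ↦ ?_
  simpa using hc.1

/-- Successive approximation: elements whose leading forms generate the leading forms of `I` in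
degree `n`, from where on the filtration is stable, generate `I ⊓ b ^ n`. -/
lemma mem_span_range_of_isAdicComplete [IsAdicComplete (a.map (algebraMap R S)) S]
    (hsurj : ∀ s : S, ∃ r : R, s - algebraMap R S r ∈ a.map (algebraMap R S)) (I : Ideal S)
    (n : ℕ) (hn : ∀ k, (leadingFormFiltration a I).N (n + k) =
      a ^ k • (leadingFormFiltration a I).N n)
    {ι : Type*} [Fintype ι] (c : ι → R)
    (hc : Submodule.span R (Set.range c) = (leadingFormFiltration a I).N n)
    (y : ι → S) (hyI : ∀ j, y j ∈ I)
    (hy : ∀ j, y j - algebraMap R S (c j) ∈ (a.map (algebraMap R S)) ^ (n + 1))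
    {x : S} (hxI : x ∈ I) (hx : x ∈ (a.map (algebraMap R S)) ^ n) :
    x ∈ Ideal.span (Set.range y) := by
  set b := a.map (algebraMap R S)
  have step (k : ℕ) (z : {z // z ∈ I ⊓ b ^ (n + k)}) : ∃ r : ι → R, (∀ j, r j ∈ a ^ k) ∧
      z.1 - ∑ j, algebraMap R S (r j) * y j ∈ I ⊓ b ^ (n + (k + 1)) := by
    obtain ⟨z, hzI, hz⟩ := z
    obtain ⟨d, hd, hzd⟩ := exists_algebraMap_sub_mem_map_pow a hsurj _ hz
    have hd' : d ∈ (leadingFormFiltration a I).N (n + k) := ⟨hd, z, hzI, hzd⟩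
    rw [hn, ← hc, Submodule.mem_ideal_smul_span_iff_exists_sum] at hd'
    obtain ⟨r, hr, rfl⟩ := hd'
    rw [Finsupp.sum_fintype _ _ (by simp)] at hzd
    refine ⟨r, hr, sub_mem hzI (sum_mem fun j _ ↦ Ideal.mul_mem_left _ _ (hyI j)), ?_⟩
    have key : ∑ j, algebraMap R S (r j) * (y j - algebraMap R S (c j)) ∈ b ^ (n + (k + 1)) := by
      refine sum_mem fun j _ ↦ ?_
      rw [show n + (k + 1) = k + (n + 1) by lia, pow_add]
      refine Ideal.mul_mem_mul ?_ (hy j)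
      rw [← Ideal.map_pow]
      exact Ideal.mem_map_of_mem _ (hr j)
    change _ ∈ b ^ (n + k + 1)
    convert sub_mem hzd key using 1
    simp only [mul_sub, Finset.sum_sub_distrib, map_sum, smul_eq_mul, map_mul]
    ring
  choose r hra hr using step
  let z : (k : ℕ) → {z // z ∈ I ⊓ b ^ (n + k)} := fun k ↦
    Nat.rec ⟨x, hxI, hx⟩ (fun k z ↦ ⟨_, hr k z⟩) k
  let t (j : ι) (k : ℕ) : S := ∑ i ∈ Finset.range k, algebraMap R S (r i (z i) j)
  have hz (k : ℕ) : (z k).1 = x - ∑ j, t j k * y j := by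
    induction k with
    | zero => simp [z, t]
    | succ k ih =>
      change (z k).1 - ∑ j, algebraMap R S (r k (z k) j) * y j = _
      simp only [ih, t, Finset.sum_range_succ, add_mul, Finset.sum_add_distrib, sub_sub]
  have hlim (j : ι) : ∃ T : S, ∀ k, t j k - T ∈ b ^ k := by
    obtain ⟨T, hT⟩ := IsPrecomplete.prec' (I := b) (M := S) (t j) fun {k l} hkl ↦ by
      rw [SModEq.comm, SModEq.sub_mem, smul_eq_mul, Ideal.mul_top,
        ← Finset.sum_Ico_eq_sub _ hkl]
      refine sum_mem fun i hi ↦ Ideal.pow_le_pow_right (Finset.mem_Ico.mp hi).1 ?_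
      rw [← Ideal.map_pow]
      exact Ideal.mem_map_of_mem _ (hra i _ j)
    exact ⟨T, fun k ↦ by simpa [SModEq.sub_mem] using hT k⟩
  choose T hT using hlim
  have hxT : x - ∑ j, T j * y j = 0 := by
    refine IsHausdorff.haus' (I := b) _ fun k ↦ ?_
    rw [SModEq.zero, smul_eq_mul, Ideal.mul_top]
    have h : ∑ j, (t j k - T j) * y j ∈ b ^ k :=
      sum_mem fun j _ ↦ Ideal.mul_mem_right _ _ (hT j k)
    convert add_mem (Ideal.pow_le_pow_right (Nat.le_add_left k n) (z k).2.2) h using 1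
    rw [hz]
    simp only [sub_mul, Finset.sum_sub_distrib]
    ring
  rw [sub_eq_zero.mp hxT]
  exact sum_mem fun j _ ↦ Ideal.mul_mem_left _ _ (Ideal.subset_span ⟨j, rfl⟩)

theorem isNoetherianRing_of_isAdicComplete_map [IsNoetherianRing R]
    [IsAdicComplete (a.map (algebraMap R S)) S]
    (hsurj : ∀ s : S, ∃ r : R, s - algebraMap R S r ∈ a.map (algebraMap R S)) :
    IsNoetherianRing S := by
  refine (isNoetherianRing_iff_ideal_fg S).mpr fun I ↦ ?_
  obtain ⟨n, hn⟩ := (leadingFormFiltration_stable a I).exists_pow_smul_eq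
  obtain ⟨m, c, hc⟩ := Submodule.fg_iff_exists_fin_generating_family.mp
    (IsNoetherian.noetherian ((leadingFormFiltration a I).N n))
  have hcmem (j : Fin m) : c j ∈ (leadingFormFiltration a I).N n :=
    hc ▸ Submodule.subset_span ⟨j, rfl⟩
  choose hca y hyI hy using fun j ↦ mem_leadingFormFiltration a |>.mp (hcmem j)
  set b := a.map (algebraMap R S)
  have hyb (j : Fin m) : y j ∈ b ^ n := by
    have h : algebraMap R S (c j) ∈ b ^ n := by
      rw [← Ideal.map_pow]
      exact Ideal.mem_map_of_mem _ (hca j)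
    simpa using add_mem (Ideal.pow_le_pow_right n.le_succ (hy j)) h
  have hfg : (I ⊓ b ^ n).FG := by
    refine Submodule.fg_def.mpr ⟨_, Set.finite_range y, le_antisymm ?_ ?_⟩
    · rw [Submodule.span_le]
      rintro _ ⟨j, rfl⟩
      exact ⟨hyI j, hyb j⟩
    · rintro x ⟨hxI, hx⟩
      exact mem_span_range_of_isAdicComplete a hsurj I n hn c hc y hyI hy hxI hx
  have hquot : IsNoetherianRing (S ⧸ b ^ n) := by
    refine isNoetherianRing_of_surjective R _ (algebraMap R (S ⧸ b ^ n)) fun q ↦ ?_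
    obtain ⟨s, rfl⟩ := Ideal.Quotient.mk_surjective q
    obtain ⟨r, hr⟩ := exists_sub_algebraMap_mem_map_pow a hsurj n s
    exact ⟨r, ((Ideal.Quotient.mk_eq_mk_iff_sub_mem _ _).mpr hr).symm⟩
  refine Ideal.fg_of_fg_map_of_fg_inf_ker_of_surjective (f := Ideal.Quotient.mk (b ^ n))
    (IsNoetherian.noetherian _) ?_ Ideal.Quotient.mk_surjective
  rwa [Ideal.mk_ker]

end Noetherian

section Torsion

variable {R S : Type u} [CommRing R] [CommRing S] [Algebra R S]

/-- The submodule of elements killed by a power of the ideal `b`. -/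
def idealPowTorsion {A : Type*} [CommRing A] (b : Ideal A) (M : Type*) [AddCommGroup M]
    [Module A M] : Submodule A M where
  carrier := {x | ∃ n : ℕ, ∀ s ∈ b ^ n, s • x = 0}
  add_mem' := by
    rintro x y ⟨m, hm⟩ ⟨n, hn⟩
    refine ⟨m + n, fun s hs ↦ ?_⟩
    rw [smul_add, hm s (Ideal.pow_le_pow_right (Nat.le_add_right m n) hs),
      hn s (Ideal.pow_le_pow_right (Nat.le_add_left n m) hs), add_zero]
  zero_mem' := ⟨0, fun _ _ ↦ smul_zero _⟩
  smul_mem' := by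
    rintro t x ⟨n, hn⟩
    exact ⟨n, fun s hs ↦ by rw [smul_comm, hn s hs, smul_zero]⟩

lemma mem_idealPowTorsion {A : Type*} [CommRing A] {b : Ideal A} {M : Type*} [AddCommGroup M]
    [Module A M] {x : M} : x ∈ idealPowTorsion b M ↔ ∃ n : ℕ, ∀ s ∈ b ^ n, s • x = 0 :=
  Iff.rfl

lemma smul_eq_zero_of_mem_map_pow {a : Ideal R} {M : Type*} [AddCommGroup M] [Module R M]
    [Module S M] [IsScalarTower R S M] {n : ℕ} {x : M} (hx : ∀ r ∈ a ^ n, r • x = 0) {s : S}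
    (hs : s ∈ (a.map (algebraMap R S)) ^ n) : s • x = 0 := by
  rw [← Ideal.map_pow, Ideal.map] at hs
  induction hs using Submodule.span_induction with
  | mem s h =>
    obtain ⟨r, hr, rfl⟩ := h
    rw [algebraMap_smul, hx r hr]
  | zero => exact zero_smul _ _
  | add s t _ _ hs ht => rw [add_smul, hs, ht, add_zero]
  | smul s t _ ht => rw [smul_assoc, ht, smul_zero]

/-- By the Artin-Rees lemma, a map from an ideal `I` to a `b`-torsion module kills `I ⊓ b ^ m`
for some `m`. -/
lemma exists_pow_inf_le_ker [IsNoetherianRing S] {M : Type*} [AddCommGroup M] [Module S M]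
    (b I : Ideal S) (f : I →ₗ[S] M) (hf : ∀ x, f x ∈ idealPowTorsion b M) :
    ∃ m : ℕ, ∀ x : I, (x : S) ∈ b ^ m → f x = 0 := by
  obtain ⟨k, hk⟩ : ∃ k : ℕ, ∀ s ∈ b ^ k, ∀ x, s • f x = 0 := by
    obtain ⟨p, c, hc⟩ := Submodule.fg_iff_exists_fin_generating_family.mp
      (IsNoetherian.noetherian (⊤ : Submodule S I))
    choose n hn using fun j ↦ hf (c j)
    refine ⟨∑ j, n j, fun s hs x ↦ ?_⟩
    have hx : x ∈ Submodule.span S (Set.range c) := hc ▸ Submodule.mem_top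
    induction hx using Submodule.span_induction with
    | mem x h =>
      obtain ⟨j, rfl⟩ := h
      exact hn j s (Ideal.pow_le_pow_right
        (Finset.single_le_sum (f := n) (fun _ _ ↦ Nat.zero_le _) (Finset.mem_univ j)) hs)
    | zero => simp
    | add x y _ _ hx hy => rw [map_add, smul_add, hx, hy, add_zero]
    | smul t x _ hx => rw [map_smul, smul_comm, hx, smul_zero]
  obtain ⟨l, hl⟩ := Ideal.exists_pow_inf_eq_pow_smul b (M := S) I
  refine ⟨l + k, fun x hx ↦ ?_⟩
  have hmem : (x : S) ∈ b ^ k • I := by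
    have h : (x : S) ∈ b ^ (l + k) • (⊤ : Ideal S) ⊓ I := ⟨by simpa using hx, x.2⟩
    rw [hl _ (Nat.le_add_right l k), Nat.add_sub_cancel_left] at h
    exact Submodule.smul_mono le_rfl inf_le_right h
  have hle : b ^ k • I ≤ (LinearMap.ker f).map I.subtype := by
    refine Submodule.smul_le.mpr fun s hs t ht ↦ ?_
    refine ⟨s • ⟨t, ht⟩, ?_, rfl⟩
    rw [SetLike.mem_coe, LinearMap.mem_ker, map_smul, hk s hs]
  obtain ⟨x', hx', h⟩ := hle hmem
  rwa [← Subtype.ext (a1 := x') (a2 := x) h]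

theorem baer_idealPowTorsion [IsNoetherianRing S] (a : Ideal R)
    (hsurj : ∀ s : S, ∃ r : R, s - algebraMap R S r ∈ a.map (algebraMap R S))
    (M : Type u) [AddCommGroup M] [Module R M] [Module S M] [IsScalarTower R S M]
    [Module.Injective R M] :
    Module.Baer S (idealPowTorsion (a.map (algebraMap R S)) M) := by
  set b := a.map (algebraMap R S)
  intro I f
  let f' : I →ₗ[S] M := (idealPowTorsion b M).subtype ∘ₗ f
  obtain ⟨m, hm⟩ := exists_pow_inf_le_ker b I f' fun x ↦ (f x).2
  let q : S →ₗ[R] S ⧸ b ^ m := (Submodule.mkQ (b ^ m)).restrictScalars R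
  let p : I →ₗ[R] S ⧸ b ^ m := q ∘ₗ I.subtype.restrictScalars R
  have hp (x : I) : p x = 0 ↔ (x : S) ∈ b ^ m := Submodule.Quotient.mk_eq_zero _
  obtain ⟨h, hh⟩ := Module.Injective.out ((LinearMap.ker p).liftQ p le_rfl)
    (LinearMap.ker_eq_bot.mp (Submodule.ker_liftQ_eq_bot' _ p rfl))
    ((LinearMap.ker p).liftQ (f'.restrictScalars R) fun x hx ↦ hm x ((hp x).mp hx))
  let g : S →ₗ[R] M := h ∘ₗ q
  have hg_ext (x : I) : g x = f' x := hh (Submodule.Quotient.mk x)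
  have hg_zero {s : S} (hs : s ∈ b ^ m) : g s = 0 := by
    have : q s = 0 := (Submodule.Quotient.mk_eq_zero _).mpr hs
    rw [LinearMap.comp_apply, this, map_zero]
  have hg_tor (t : S) {s : S} (hs : s ∈ b ^ m) : s • g t = 0 := by
    refine smul_eq_zero_of_mem_map_pow (fun r hr ↦ ?_) hs
    rw [← map_smul, Algebra.smul_def]
    refine hg_zero (Ideal.mul_mem_right _ _ ?_)
    rw [← Ideal.map_pow]
    exact Ideal.mem_map_of_mem _ hr
  let gS : S →ₗ[S] M :=
    { g with
      map_smul' := fun s t ↦ by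
        obtain ⟨r, hr⟩ := exists_sub_algebraMap_mem_map_pow a hsurj m s
        change g (s * t) = s • g t
        rw [← sub_add_cancel s (algebraMap R S r), add_mul, map_add, add_smul, hg_tor t hr,
          hg_zero (Ideal.mul_mem_right _ _ hr), algebraMap_smul, ← Algebra.smul_def, map_smul] }
  refine ⟨gS.codRestrict (idealPowTorsion b M) fun t ↦
    mem_idealPowTorsion.mpr ⟨m, fun s hs ↦ hg_tor t hs⟩, fun x hx ↦ Subtype.ext ?_⟩
  exact hg_ext ⟨x, hx⟩

lemma injective_restrictScalars_of_flat [Module.Flat R S] (M : Type u) [AddCommGroup M]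
    [Module R M] [Module S M] [IsScalarTower R S M] [Module.Injective S M] :
    Module.Injective R M where
  out X Y _ _ _ _ i hi f := by
    have hi' : Function.Injective (i.baseChange S) :=
      Module.Flat.lTensor_preserves_injective_linearMap i hi
    obtain ⟨h, hh⟩ := Module.Injective.out (i.baseChange S) hi' (f.liftBaseChange S)
    exact ⟨h.restrictScalars R ∘ₗ TensorProduct.mk R S Y 1,
      fun x ↦ by simpa using hh (1 ⊗ₜ x)⟩

theorem injective_iff_injective_of_torsion [IsNoetherianRing S] [Module.Flat R S] (a : Ideal R)
    (hsurj : ∀ s : S, ∃ r : R, s - algebraMap R S r ∈ a.map (algebraMap R S))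
    (M : Type u) [AddCommGroup M] [Module R M] [Module S M] [IsScalarTower R S M]
    (htor : ∀ x : M, ∃ n : ℕ, ∀ r ∈ a ^ n, r • x = 0) :
    Module.Injective R M ↔ Module.Injective S M := by
  refine ⟨fun _ ↦ ?_, fun _ ↦ injective_restrictScalars_of_flat (S := S) M⟩
  have htop : idealPowTorsion (a.map (algebraMap R S)) M = ⊤ := by
    refine eq_top_iff.mpr fun x _ ↦ ?_
    obtain ⟨n, hn⟩ := htor x
    exact ⟨n, fun s hs ↦ smul_eq_zero_of_mem_map_pow hn hs⟩
  exact ((baer_idealPowTorsion a hsurj M).of_equiv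
    (LinearEquiv.ofTop _ htop)).injective

/-- A torsion module over the completion comes from the base ring. -/
noncomputable def tensorEquivOfTorsion (a : Ideal R)
    (hsurj : ∀ s : S, ∃ r : R, s - algebraMap R S r ∈ a.map (algebraMap R S))
    (M : Type u) [AddCommGroup M] [Module R M] [Module S M] [IsScalarTower R S M]
    (htor : ∀ x : M, ∃ n : ℕ, ∀ r ∈ a ^ n, r • x = 0) :
    TensorProduct R S M ≃ₗ[S] M :=
  LinearEquiv.ofBijective ((LinearMap.id : M →ₗ[R] M).liftBaseChange S) (by
    have key (s : S) (x : M) : s ⊗ₜ[R] x = 1 ⊗ₜ[R] (s • x) := by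
      obtain ⟨n, hn⟩ := htor x
      obtain ⟨r, hr⟩ := exists_sub_algebraMap_mem_map_pow a hsurj n s
      have h1 : (s - algebraMap R S r) • x = 0 := smul_eq_zero_of_mem_map_pow hn hr
      have h2 : (s - algebraMap R S r) • ((1 : S) ⊗ₜ[R] x) = 0 :=
        smul_eq_zero_of_mem_map_pow (a := a) (n := n) (x := (1 : S) ⊗ₜ[R] x)
          (fun r hr ↦ by rw [← TensorProduct.tmul_smul, hn r hr, TensorProduct.tmul_zero]) hr
      rw [sub_smul, sub_eq_zero, algebraMap_smul] at h1
      rw [TensorProduct.smul_tmul', smul_eq_mul, mul_one, TensorProduct.sub_tmul, sub_eq_zero,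
        Algebra.algebraMap_eq_smul_one, TensorProduct.smul_tmul] at h2
      rw [h1, h2]
    refine ⟨(injective_iff_map_eq_zero _).mpr fun z hz ↦ ?_, fun x ↦ ⟨1 ⊗ₜ x, by simp⟩⟩
    obtain ⟨x, rfl⟩ : ∃ x : M, z = 1 ⊗ₜ[R] x := by
      clear hz
      induction z with
      | zero => exact ⟨0, by simp⟩
      | tmul s x => exact ⟨s • x, key s x⟩
      | add z w hz hw =>
        obtain ⟨x, rfl⟩ := hz
        obtain ⟨y, rfl⟩ := hw
        exact ⟨x + y, (TensorProduct.tmul_add _ _ _).symm⟩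
    rw [LinearMap.liftBaseChange_tmul, one_smul, LinearMap.id_apply] at hz
    rw [hz, TensorProduct.tmul_zero])

end Torsion

section Completion

variable {R : Type u} [CommRing R] [IsNoetherianRing R] (a : Ideal R)

lemma AdicCompletion.exists_sub_algebraMap_mem_map (s : AdicCompletion a R) :
    ∃ r : R, s - algebraMap R (AdicCompletion a R) r ∈
      a.map (algebraMap R (AdicCompletion a R)) := by
  obtain ⟨r, hr⟩ := Ideal.Quotient.mk_surjective (evalOneₐ a s)
  refine ⟨r, ?_⟩
  rw [← ker_evalOneₐ_eq_map a (IsNoetherian.noetherian a), RingHom.mem_ker, map_sub, sub_eq_zero]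
  exact hr.symm

instance AdicCompletion.isNoetherianRing : IsNoetherianRing (AdicCompletion a R) :=
  haveI : IsAdicComplete (a.map (algebraMap R (AdicCompletion a R))) (AdicCompletion a R) :=
    (IsAdicComplete.map_algebraMap_iff a (AdicCompletion a R)).mpr
      (AdicCompletion.isAdicComplete (IsNoetherian.noetherian a))
  isNoetherianRing_of_isAdicComplete_map a (exists_sub_algebraMap_mem_map a)

end Completion

section InjectiveDimension

variable {R S : Type u} [CommRing R] [CommRing S] [Algebra R S]

lemma hasInjectiveDimensionLT_quotient_iff {A : Type u} [CommRing A] {N E : Type u}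
    [AddCommGroup N] [Module A N] [AddCommGroup E] [Module A E] [Module.Injective A E]
    (f : N →ₗ[A] E) (hf : Function.Injective f) (n : ℕ) :
    HasInjectiveDimensionLT (ModuleCat.of A (E ⧸ LinearMap.range f)) (n + 1) ↔
      HasInjectiveDimensionLT (ModuleCat.of A N) (n + 2) := by
  let T : ShortComplex (ModuleCat.{u} A) :=
    ModuleCat.shortComplexOfCompEqZero _ _ f.exact_map_mkQ_range.linearMap_comp_eq_zero
  have hT : T.ShortExact := ModuleCat.shortComplex_shortExact T
    f.exact_map_mkQ_range hf (Submodule.mkQ_surjective _)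
  exact hT.hasInjectiveDimensionLT_X₃_iff n (Module.injective_object_of_injective_module A E)

/-- A torsion module embeds into a torsion injective module. -/
lemma exists_injective_of_torsion [IsNoetherianRing S] [Module.Flat R S] (a : Ideal R)
    (hsurj : ∀ s : S, ∃ r : R, s - algebraMap R S r ∈ a.map (algebraMap R S))
    (N : Type u) [AddCommGroup N] [Module S N] [Module R N] [IsScalarTower R S N]
    (htor : ∀ x : N, ∃ n : ℕ, ∀ r ∈ a ^ n, r • x = 0) :
    ∃ (E : Type u) (_ : AddCommGroup E) (_ : Module S E) (_ : Module R E)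
      (_ : IsScalarTower R S E) (_ : Module.Injective S E) (f : N →ₗ[S] E),
      Function.Injective f ∧ ∀ x : E, ∃ n : ℕ, ∀ r ∈ a ^ n, r • x = 0 := by
  obtain ⟨J, _, f, _⟩ := EnoughInjectives.presentation (ModuleCat.of S N)
  have hf : Function.Injective f.hom := (ModuleCat.mono_iff_injective f).mp ‹_›
  have : Module.Injective S J := Module.injective_module_of_injective_object S J
  let : Module R J := Module.compHom J (algebraMap R S)
  have : IsScalarTower R S J := IsScalarTower.of_algebraMap_smul fun _ _ ↦ rfl
  have : Module.Injective R J := injective_restrictScalars_of_flat (S := S) J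
  have hmem (x : N) : f.hom x ∈ idealPowTorsion (a.map (algebraMap R S)) J := by
    obtain ⟨n, hn⟩ := htor x
    refine mem_idealPowTorsion.mpr ⟨n, fun s hs ↦ ?_⟩
    rw [← map_smul, smul_eq_zero_of_mem_map_pow hn hs, map_zero]
  refine ⟨idealPowTorsion (a.map (algebraMap R S)) J, inferInstance, inferInstance,
    inferInstance, inferInstance, (baer_idealPowTorsion a hsurj J).injective,
    f.hom.codRestrict _ hmem, fun x y h ↦ hf (congrArg Subtype.val h), fun x ↦ ?_⟩
  obtain ⟨n, hn⟩ := mem_idealPowTorsion.mp x.2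
  refine ⟨n, fun r hr ↦ Subtype.ext ?_⟩
  have := hn (algebraMap R S r) (by rw [← Ideal.map_pow]; exact Ideal.mem_map_of_mem _ hr)
  rwa [algebraMap_smul] at this

theorem hasInjectiveDimensionLT_iff_of_torsion [IsNoetherianRing S] [Module.Flat R S]
    (a : Ideal R)
    (hsurj : ∀ s : S, ∃ r : R, s - algebraMap R S r ∈ a.map (algebraMap R S)) (n : ℕ)
    (N : Type u) [AddCommGroup N] [Module R N] [Module S N] [IsScalarTower R S N]
    (htor : ∀ x : N, ∃ n : ℕ, ∀ r ∈ a ^ n, r • x = 0) :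
    HasInjectiveDimensionLT (ModuleCat.of R N) (n + 1) ↔
      HasInjectiveDimensionLT (ModuleCat.of S N) (n + 1) := by
  induction n generalizing N with
  | zero =>
    rw [zero_add, ← injective_iff_hasInjectiveDimensionLT_one,
      ← injective_iff_hasInjectiveDimensionLT_one, ← Module.injective_iff_injective_object R N,
      ← Module.injective_iff_injective_object S N]
    exact injective_iff_injective_of_torsion a hsurj N htor
  | succ n ih =>
    obtain ⟨E, _, _, _, _, _, f, hf, hE⟩ := exists_injective_of_torsion a hsurj N htor
    have : Module.Injective R E := injective_restrictScalars_of_flat (S := S) E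
    rw [← hasInjectiveDimensionLT_quotient_iff f hf n,
      ← hasInjectiveDimensionLT_quotient_iff (f.restrictScalars R) hf n]
    refine Iff.trans ?_ (ih (E ⧸ LinearMap.range f) fun x ↦ ?_)
    · rfl
    · obtain ⟨x, rfl⟩ := Submodule.Quotient.mk_surjective _ x
      obtain ⟨n, hn⟩ := hE x
      exact ⟨n, fun r hr ↦ by rw [← Submodule.Quotient.mk_smul, hn r hr,
        Submodule.Quotient.mk_zero]⟩

end InjectiveDimension

section InjectiveResolution

open scoped ZeroObject

variable {C : Type*} [Category* C] [Abelian C]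

lemma hasInjectiveDimensionLT_cycles (K : CochainComplex C ℕ) (n : ℕ)
    (hinj : ∀ i, Injective (K.X i)) (hzero : ∀ i, n < i → IsZero (K.X i))
    (hex : ∀ i, i ≠ 0 → IsZero (K.homology i)) (j i : ℕ) (hij : i + j = n + 1) :
    HasInjectiveDimensionLT (K.cycles i) j := by
  induction j generalizing i with
  | zero =>
    exact ((hzero i (by lia)).of_mono (K.iCycles i)).hasInjectiveDimensionLT_zero
  | succ j ih =>
    have hepi : Epi (K.toCycles i (i + 1)) := by
      have h := K.homologyIsCokernel i (i + 1) (by simp)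
      exact Preadditive.epi_of_isZero_cokernel' _ h (hex (i + 1) i.succ_ne_zero)
    have hw : K.iCycles i ≫ K.toCycles i (i + 1) = 0 := by
      rw [← cancel_mono (K.iCycles (i + 1))]
      simp
    let T : ShortComplex C := ShortComplex.mk (K.iCycles i) (K.toCycles i (i + 1)) hw
    have hT : T.ShortExact :=
      { exact := T.exact_of_f_is_kernel
          (isKernelOfComp (K.iCycles (i + 1)) (K.d i (i + 1))
            (K.cyclesIsKernel i (i + 1) (by simp)) hw (by simp)) }
    have : Injective (K.X i) := hinj i
    exact hT.hasInjectiveDimensionLT_X₁ j (ih (i + 1) (by lia))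
      (hasInjectiveDimensionLT_of_ge (K.X i) 1 (j + 1) (by lia))

lemma exists_shortExact_of_hasInjectiveDimensionLT [EnoughInjectives C] (n : ℕ) (X : C)
    (hX : HasInjectiveDimensionLT X (n + 1)) :
    ∃ (J Q : C) (i : X ⟶ J) (p : J ⟶ Q) (w : i ≫ p = 0), Injective J ∧
      HasInjectiveDimensionLT Q n ∧ (ShortComplex.mk i p w).ShortExact := by
  cases n with
  | zero =>
    let T : ShortComplex C := ShortComplex.mk (𝟙 X) (0 : X ⟶ 0) comp_zero
    have hf : IsIso T.f := inferInstanceAs (IsIso (𝟙 X))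
    exact ⟨X, 0, 𝟙 X, 0, comp_zero, injective_iff_hasInjectiveDimensionLT_one.mpr hX,
      inferInstance, (ShortComplex.Splitting.ofIsIsoOfIsZero T hf (isZero_zero C)).shortExact⟩
  | succ n =>
    obtain ⟨J, hJ, i, hi⟩ := EnoughInjectives.presentation X
    have hT : (ShortComplex.mk i (cokernel.π i) (by simp)).ShortExact :=
      { exact := ShortComplex.exact_cokernel i }
    exact ⟨J, cokernel i, i, cokernel.π i, by simp, hJ,
      (hT.hasInjectiveDimensionLT_X₃_iff n hJ).mpr hX, hT⟩

/-- An object of injective dimension less than `n` has an injective resolution vanishing in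
degrees at least `n`. -/
lemma exists_injective_complex [EnoughInjectives C] (n : ℕ) (X : C)
    (hX : HasInjectiveDimensionLT X n) :
    ∃ (K : CochainComplex C ℕ) (ι : X ⟶ K.X 0) (w : ι ≫ K.d 0 1 = 0), Mono ι ∧
      (ShortComplex.mk ι (K.d 0 1) w).Exact ∧ (∀ i, Injective (K.X i)) ∧
      (∀ i, n ≤ i → IsZero (K.X i)) ∧ ∀ i, i ≠ 0 → K.ExactAt i := by
  induction n generalizing X with
  | zero =>
    have hX : IsZero X := isZero_of_hasInjectiveDimensionLT_zero X
    have hzero (i : ℕ) : IsZero ((0 : CochainComplex C ℕ).X i) :=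
      (HomologicalComplex.eval C _ i).map_isZero (isZero_zero _)
    refine ⟨0, 0, by simp, ⟨fun _ _ _ ↦ hX.eq_of_tgt _ _⟩,
      ShortComplex.exact_of_isZero_X₂ _ (hzero 0), fun i ↦ (hzero i).injective,
      fun i _ ↦ hzero i, fun i _ ↦ ShortComplex.exact_of_isZero_X₂ _ (hzero i)⟩
  | succ n ih =>
    obtain ⟨J, Q, i, p, w, hJ, hQ, hT⟩ := exists_shortExact_of_hasInjectiveDimensionLT n X hX
    obtain ⟨K, ι, hι, hmono, hex, hinj, hzero, hexact⟩ := ih Q hQ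
    have hi : Mono i := hT.mono_f
    have hp : Epi p := hT.epi_g
    have hd : (p ≫ ι) ≫ K.d 0 1 = 0 := by rw [Category.assoc, hι, comp_zero]
    refine ⟨CochainComplex.augment K (p ≫ ι) hd, i, ?_, hi, ?_, ?_, ?_, ?_⟩
    · change i ≫ p ≫ ι = 0
      rw [reassoc_of% w, zero_comp]
    · change (ShortComplex.mk i (p ≫ ι) _).Exact
      let φ : ShortComplex.mk i p w ⟶
          ShortComplex.mk i (p ≫ ι) (by rw [reassoc_of% w, zero_comp]) :=
        { τ₁ := 𝟙 _, τ₂ := 𝟙 _, τ₃ := ι }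
      have : Epi φ.τ₁ := inferInstanceAs (Epi (𝟙 _))
      have : IsIso φ.τ₂ := inferInstanceAs (IsIso (𝟙 _))
      have : Mono φ.τ₃ := hmono
      exact (ShortComplex.exact_iff_of_epi_of_isIso_of_mono φ).mp hT.exact
    · rintro (_ | j)
      · exact hJ
      · exact hinj j
    · rintro (_ | j) hj
      · lia
      · exact hzero j (by lia)
    · rintro (_ | _ | j) hj
      · exact absurd rfl hj
      · rw [HomologicalComplex.exactAt_iff' _ 0 1 2 (by simp) (by simp)]
        change (ShortComplex.mk (p ≫ ι) (K.d 0 1) hd).Exact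
        let φ : ShortComplex.mk (p ≫ ι) (K.d 0 1) hd ⟶ ShortComplex.mk ι (K.d 0 1) hι :=
          { τ₁ := p, τ₂ := 𝟙 _, τ₃ := 𝟙 _ }
        have : Epi φ.τ₁ := hp
        have : IsIso φ.τ₂ := inferInstanceAs (IsIso (𝟙 _))
        have : Mono φ.τ₃ := inferInstanceAs (Mono (𝟙 _))
        exact (ShortComplex.exact_iff_of_epi_of_isIso_of_mono φ).mpr hex
      · rw [HomologicalComplex.exactAt_iff' _ (j + 1) (j + 2) (j + 3) (by simp) (by simp)]
        exact (HomologicalComplex.exactAt_iff' K j (j + 1) (j + 2) (by simp) (by simp)).mp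
          (hexact (j + 1) j.succ_ne_zero)

end InjectiveResolution

theorem injDimLE_iff {A : Type u} [CommRing A] (N : Type u) [AddCommGroup N] [Module A N]
    (n : ℕ) : InjDimLE A N n ↔ HasInjectiveDimensionLT (ModuleCat.of A N) (n + 1) := by
  constructor
  · rintro ⟨K, hinj, hzero, hex, ⟨e⟩⟩
    have := hasInjectiveDimensionLT_cycles K n hinj
      (fun i hi ↦ have := hzero i hi; ModuleCat.isZero_of_subsingleton _) hex (n + 1) 0 (by simp)
    exact hasInjectiveDimensionLT_of_iso (K.isoHomologyπ₀ ≪≫ e) (n + 1)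
  · intro h
    obtain ⟨K, ι, w, hmono, hexact, hinj, hzero, hex⟩ := exists_injective_complex (n + 1) _ h
    refine ⟨K, hinj, fun i hi ↦ ModuleCat.subsingleton_of_isZero (hzero i hi),
      fun i hi ↦ (hex i hi).isZero_homology, ⟨?_⟩⟩
    have : Mono (ShortComplex.mk ι (K.d 0 1) w).f := hmono
    exact K.isoHomologyπ₀.symm ≪≫
      (K.cyclesIsKernel 0 1 (by simp)).conePointUniqueUpToIso hexact.fIsKernel

section FlatDimension

/-- Flat dimension is transported along exact functors preserving flatness. -/
lemma FlatDimLE.map {R S : Type u} [CommRing R] [CommRing S] {N : Type u}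
    [AddCommGroup N] [Module R N] {M : Type u} [AddCommGroup M] [Module S M] {n : ℕ}
    (h : FlatDimLE R N n) (F : ModuleCat.{u} R ⥤ ModuleCat.{u} S)
    [F.Additive] [PreservesFiniteLimits F] [PreservesFiniteColimits F]
    (hF : ∀ X : ModuleCat.{u} R, Module.Flat R X → Module.Flat S (F.obj X))
    (e : F.obj (ModuleCat.of R N) ≅ ModuleCat.of S M) : FlatDimLE S M n := by
  obtain ⟨K, hflat, hzero, hex, ⟨eN⟩⟩ := h
  let eH (i : ℕ) : ((F.mapHomologicalComplex _).obj K).homology i ≅ F.obj (K.homology i) :=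
    (K.sc i).mapHomologyIso F
  refine ⟨(F.mapHomologicalComplex _).obj K, fun i ↦ hF _ (hflat i), fun i hi ↦ ?_,
    fun i hi ↦ (F.map_isZero (hex i hi)).of_iso (eH i), ⟨eH 0 ≪≫ F.mapIso eN ≪≫ e⟩⟩
  have := hzero i hi
  exact ModuleCat.subsingleton_of_isZero
    (F.map_isZero (ModuleCat.isZero_of_subsingleton (K.X i)))

variable {R S : Type u} [CommRing R] [CommRing S] [Algebra R S]

theorem flatDimLE_iff_of_torsion [Module.Flat R S] (a : Ideal R)
    (hsurj : ∀ s : S, ∃ r : R, s - algebraMap R S r ∈ a.map (algebraMap R S))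
    (N : Type u) [AddCommGroup N] [Module R N] [Module S N] [IsScalarTower R S N]
    (htor : ∀ x : N, ∃ n : ℕ, ∀ r ∈ a ^ n, r • x = 0) (n : ℕ) :
    FlatDimLE R N n ↔ FlatDimLE S N n := by
  obtain ⟨f, hf⟩ : ∃ f : R →+* S, ‹Algebra R S› = f.toAlgebra :=
    ⟨algebraMap R S, Algebra.algebra_ext _ _ fun _ ↦ rfl⟩
  subst hf
  let := f.toAlgebra
  constructor
  · intro h
    have : PreservesFiniteLimits (ModuleCat.extendScalars.{u, u, u} f) :=
      ModuleCat.preservesFiniteLimits_extendScalars_of_flat ‹Module.Flat R S›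
    have hadj := ModuleCat.extendRestrictScalarsAdj.{u} f
    have : (ModuleCat.extendScalars.{u, u, u} f).Additive :=
      hadj.left_adjoint_additive
    have := hadj.leftAdjoint_preservesColimits
    refine h.map (ModuleCat.extendScalars f) (fun X _ ↦ ?_)
      (tensorEquivOfTorsion a hsurj N htor).toModuleIso
    exact inferInstanceAs (Module.Flat S (TensorProduct R S X))
  · intro h
    let e : N ≃ₗ[R] (ModuleCat.restrictScalars f).obj (ModuleCat.of S N) :=
      { AddEquiv.refl N with map_smul' := fun r x ↦ (algebraMap_smul S r x).symm }
    refine h.map (ModuleCat.restrictScalars f) (fun X _ ↦ ?_) e.symm.toModuleIso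
    let : Module R X := Module.compHom X f
    have : IsScalarTower R S X := IsScalarTower.of_algebraMap_smul fun _ _ ↦ rfl
    exact Module.Flat.trans R S X

theorem flat_iff_flat_of_torsion [Module.Flat R S] (a : Ideal R)
    (hsurj : ∀ s : S, ∃ r : R, s - algebraMap R S r ∈ a.map (algebraMap R S))
    (N : Type u) [AddCommGroup N] [Module R N] [Module S N] [IsScalarTower R S N]
    (htor : ∀ x : N, ∃ n : ℕ, ∀ r ∈ a ^ n, r • x = 0) :
    Module.Flat R N ↔ Module.Flat S N :=
  ⟨fun _ ↦ Module.Flat.of_linearEquiv (tensorEquivOfTorsion a hsurj N htor).symm,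
    fun _ ↦ Module.Flat.trans R S N⟩

end FlatDimension

/-- Let `R` be commutative noetherian, `a ⊊ R` an ideal, `R̂` the `a`-adic
completion, and `N` an `R̂`-module which is `a`-torsion over `R`. Then the flat dimension of
`N` over `R` equals that over `R̂`, the injective dimension of `N` over `R` equals that over
`R̂`; in particular `N` is flat (resp. injective) over `R` iff it is so over `R̂`. -/
theorem flat_inj_dim_eq_over_completion_of_torsion
    {R : Type u} [CommRing R] [IsNoetherianRing R] (a : Ideal R) (ha : a ≠ ⊤)
    (N : Type u) [AddCommGroup N] [Module R N] [Module (AdicCompletion a R) N]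
    [IsScalarTower R (AdicCompletion a R) N]
    (htor : ∀ x : N, ∃ n : ℕ, ∀ r ∈ a ^ n, r • x = (0 : N)) :
    (∀ n : ℕ, FlatDimLE R N n ↔ FlatDimLE (AdicCompletion a R) N n) ∧
    (∀ n : ℕ, InjDimLE R N n ↔ InjDimLE (AdicCompletion a R) N n) ∧
    (Module.Flat R N ↔ Module.Flat (AdicCompletion a R) N) ∧
    (Module.Injective R N ↔ Module.Injective (AdicCompletion a R) N) := by
  have hsurj := AdicCompletion.exists_sub_algebraMap_mem_map a
  refine ⟨flatDimLE_iff_of_torsion a hsurj N htor, fun n ↦ ?_,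
    flat_iff_flat_of_torsion a hsurj N htor, injective_iff_injective_of_torsion a hsurj N htor⟩
  rw [injDimLE_iff, injDimLE_iff]
  exact hasInjectiveDimensionLT_iff_of_torsion a hsurj n N htor
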